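/- arXiv:1709.05896 — 5 statements merged into one kernel-verified Lean document; each statement's English description precedes it below -/
import Mathlib

section
/- Consider the schedule produced by BALANCE. For any two jobs j1 and j2: if τ_{j1} = τ_{j2}, then j1 and j2 are processed in FIFO order (i.e., in order of their release times); if τ_{j1} ≠ τ_{j2} and j2 is processed after j1, then r_{j2} ≥ r_{j1} − λ(j1). -/
open Finset MeasureTheory ProbabilityTheory

attribute [local instance] Classical.propDecidable

/-- The position directly preceding position `i` (equal to `i` when `i = 0`). -/
def prevFin {n : ℕ} (i : Fin n) : Fin n :=
  ⟨i.val - 1, Nat.lt_of_le_of_lt (Nat.pred_le _) i.isLt⟩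

/-- An instance of the scheduling problem with `n` jobs: each job `j` has a release
time `r j ≥ 0`, a processing time `p j` and a type `τ j`; switching between types
requires a setup taking `s ≥ 0` time units. -/
structure SInstance (n : ℕ) where
  r : Fin n → ℝ
  p : Fin n → ℝ
  τ : Fin n → ℕ
  s : ℝ
  hr : ∀ j, 0 ≤ r j
  hs : 0 ≤ s

namespace SInstance

variable {n : ℕ}

/-- The multiplicatively perturbed instance with processing times `(1 + x j) * p j`. -/
def perturb (I : SInstance n) (x : Fin n → ℝ) : SInstance n :=
  { I with p := fun j => (1 + x j) * I.p j }

/-- Total processing time of the jobs satisfying `P` (e.g. released in some interval). -/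
noncomputable def workloadIn (I : SInstance n) (P : Fin n → Prop) : ℝ :=
  ∑ j : Fin n, if P j then I.p j else 0

/-- The smallest release time. -/
noncomputable def rmin (I : SInstance n) : ℝ := sInf (Set.range I.r)

/-- The largest release time. -/
noncomputable def rmax (I : SInstance n) : ℝ := sSup (Set.range I.r)

end SInstance

/-- A feasible non-preemptive single machine schedule: `π i` is the job processed
`i`-th and `t j` is the start time of job `j`.  A job starts no earlier than its
release time, a setup of `s` time units precedes the first job, and between two
consecutive jobs of different types a setup of `s` time units must take place. -/
structure Schedule {n : ℕ} (I : SInstance n) where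
  π : Fin n ≃ Fin n
  t : Fin n → ℝ
  h_release : ∀ j, I.r j ≤ t j
  h_first : ∀ h : 0 < n, I.s ≤ t (π ⟨0, h⟩)
  h_gap : ∀ i : Fin n, 0 < i.val →
    t (π (prevFin i)) + I.p (π (prevFin i)) +
      (if I.τ (π (prevFin i)) ≠ I.τ (π i) then I.s else 0) ≤ t (π i)

namespace Schedule

variable {n : ℕ} {I : SInstance n}

/-- Completion time of job `j`. -/
def c (S : Schedule I) (j : Fin n) : ℝ := S.t j + I.p j

/-- Flow time of job `j`. -/
def flow (S : Schedule I) (j : Fin n) : ℝ := S.c j - I.r j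

/-- Maximum flow time of the schedule. -/
noncomputable def maxFlow (S : Schedule I) : ℝ := sSup (Set.range S.flow)

/-- A schedule is optimal if it minimizes the maximum flow time. -/
def IsOptimal (S : Schedule I) : Prop := ∀ S' : Schedule I, S.maxFlow ≤ S'.maxFlow

/-- The overhead (setup plus idle time) directly preceding the job processed at
position `i`, i.e. the overhead associated to this job. -/
def overheadAt (S : Schedule I) (i : Fin n) : ℝ :=
  if 0 < i.val then S.t (S.π i) - S.c (S.π (prevFin i)) else S.t (S.π i)

/-- The job at position `i` starts a batch (it is the first job processed, or its
type differs from that of the previously processed job). -/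
def startsBatch (S : Schedule I) (i : Fin n) : Prop :=
  i.val = 0 ∨ I.τ (S.π (prevFin i)) ≠ I.τ (S.π i)

/-- The positions `a, …, b` form a batch: all these jobs have a common type, and the
batch is maximal. -/
def IsBatch (S : Schedule I) (a b : Fin n) : Prop :=
  a ≤ b ∧ (∀ m : Fin n, a ≤ m → m ≤ b → I.τ (S.π m) = I.τ (S.π a)) ∧
  S.startsBatch a ∧
  ∀ h : b.val + 1 < n, I.τ (S.π ⟨b.val + 1, h⟩) ≠ I.τ (S.π b)

/-- The overhead occurring in schedule `S` between the start of the first-started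
and the start of the last-started among the jobs satisfying `P` (e.g. the jobs
released in some interval): the length of this time window minus the processing
performed within it. -/
noncomputable def overheadOn (S : Schedule I) (P : Fin n → Prop) : ℝ :=
  if h : (Finset.univ.filter P).Nonempty then
    ((Finset.univ.filter P).sup' h S.t - (Finset.univ.filter P).inf' h S.t)
      - ∑ j : Fin n,
          if (Finset.univ.filter P).inf' h S.t ≤ S.t j ∧
             S.t j < (Finset.univ.filter P).sup' h S.t then I.p j else 0
  else 0

end Schedule

/-- A run of the algorithm BALANCE (with `α = 13`) on instance `I`.  `lam j` is the
value of the balance parameter λ when job `j` was scheduled and `dec j` is the time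
at which the idling machine selected job `j` (the job then starts after a setup if
needed).  The fields express: λ is a power of α starting at α and it is multiplied
by α as soon as a job completes with flow time ≥ αλ; the machine never idles
deliberately; and whenever a job is selected, it minimizes the adjusted release
time `r̄` among the already released, still unscheduled jobs (`r̄ j = r j` if `τ j`
is the type the machine is configured for, i.e. the type of the previous job, and
`r̄ j = r j + λ` otherwise), ties being broken in favor of the active type. -/
structure BalanceSchedule {n : ℕ} (I : SInstance n) extends Schedule I where
  lam : Fin n → ℝ
  dec : Fin n → ℝ
  h_lam_pow : ∀ j, ∃ q : ℕ, lam j = 13 ^ q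
  h_lam_init : ∀ h : 0 < n, lam (toSchedule.π ⟨0, h⟩) = 13
  h_lam_mono : ∀ i : Fin n, 0 < i.val →
    lam (toSchedule.π (prevFin i)) ≤ lam (toSchedule.π i)
  h_lam_bound : ∀ i : Fin n, 0 < i.val →
    toSchedule.flow (toSchedule.π (prevFin i)) < 13 * lam (toSchedule.π i)
  h_lam_min : ∀ i : Fin n, 0 < i.val →
    (lam (toSchedule.π i) = lam (toSchedule.π (prevFin i)) ∨
      lam (toSchedule.π i) ≤ toSchedule.flow (toSchedule.π (prevFin i)))
  h_avail : ∀ i : Fin n, I.r (toSchedule.π i) ≤ dec (toSchedule.π i)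
  h_dec_start : ∀ i : Fin n,
    toSchedule.t (toSchedule.π i) =
      dec (toSchedule.π i) + (if toSchedule.startsBatch i then I.s else 0)
  h_no_idle : ∀ i : Fin n, 0 < i.val →
    toSchedule.c (toSchedule.π (prevFin i)) ≤ dec (toSchedule.π i) ∧
      (dec (toSchedule.π i) = toSchedule.c (toSchedule.π (prevFin i)) ∨
        ∀ k : Fin n, i ≤ k → dec (toSchedule.π i) ≤ I.r (toSchedule.π k))
  h_first_dec : ∀ h : 0 < n, ∀ j : Fin n, dec (toSchedule.π ⟨0, h⟩) ≤ I.r j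
  h_select : ∀ i k : Fin n, i < k →
    I.r (toSchedule.π k) ≤ dec (toSchedule.π i) →
    I.r (toSchedule.π i) +
        (if 0 < i.val ∧ I.τ (toSchedule.π i) = I.τ (toSchedule.π (prevFin i)) then 0
         else lam (toSchedule.π i))
      ≤ I.r (toSchedule.π k) +
        (if 0 < i.val ∧ I.τ (toSchedule.π k) = I.τ (toSchedule.π (prevFin i)) then 0
         else lam (toSchedule.π i))
  h_tie : ∀ i k : Fin n, i < k →
    I.r (toSchedule.π k) ≤ dec (toSchedule.π i) → 0 < i.val →
    (I.r (toSchedule.π i) +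
        (if I.τ (toSchedule.π i) = I.τ (toSchedule.π (prevFin i)) then 0
         else lam (toSchedule.π i))
      = I.r (toSchedule.π k) +
        (if I.τ (toSchedule.π k) = I.τ (toSchedule.π (prevFin i)) then 0
         else lam (toSchedule.π i))) →
    I.τ (toSchedule.π k) = I.τ (toSchedule.π (prevFin i)) →
    I.τ (toSchedule.π i) = I.τ (toSchedule.π (prevFin i))

namespace BalanceSchedule

variable {n : ℕ} {I : SInstance n}

/-- The job at position `i` belongs to the subschedule `S_{α^q}`, i.e. it was
scheduled while the balance parameter had value `α^q = 13^q`. -/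
def inS (B : BalanceSchedule I) (q : ℕ) (i : Fin n) : Prop :=
  B.lam (B.toSchedule.π i) = 13 ^ q

/-- Position `b` is the first position of the subschedule `S^δ_{α^q}`: it is the
last position of `S_{α^q}` that starts a batch and whose job has flow time at most
`(α − δ)·α^q`. -/
def IsSdStart (B : BalanceSchedule I) (q : ℕ) (δ : ℝ) (b : Fin n) : Prop :=
  B.inS q b ∧ B.toSchedule.startsBatch b ∧
    B.toSchedule.flow (B.toSchedule.π b) ≤ (13 - δ) * 13 ^ q ∧
    ∀ b' : Fin n, b < b' → B.inS q b' → B.toSchedule.startsBatch b' →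
      ¬ B.toSchedule.flow (B.toSchedule.π b') ≤ (13 - δ) * 13 ^ q

end BalanceSchedule

/-- Proposition 1: in a schedule produced by BALANCE, jobs of a common
type are processed in FIFO order, and if `j₂` (of a different type than `j₁`) is
processed after `j₁`, then `r j₂ ≥ r j₁ − λ(j₁)`. -/
theorem balance_releaseDiff {n : ℕ} (I : SInstance n) (hp : ∀ j, 1 ≤ I.p j)
    (B : BalanceSchedule I) :
    (∀ i k : Fin n, i < k →
      I.τ (B.toSchedule.π i) = I.τ (B.toSchedule.π k) →
      I.r (B.toSchedule.π i) ≤ I.r (B.toSchedule.π k)) ∧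
    (∀ i k : Fin n, i < k →
      I.τ (B.toSchedule.π i) ≠ I.τ (B.toSchedule.π k) →
      I.r (B.toSchedule.π i) - B.lam (B.toSchedule.π i) ≤ I.r (B.toSchedule.π k)) := by
  refine ⟨fun i k hik hτ => ?_, fun i k hik _ => ?_⟩
  · rcases le_or_gt (I.r (B.toSchedule.π k)) (B.dec (B.toSchedule.π i)) with h | h
    · have hs := B.h_select i k hik h
      rw [hτ] at hs
      linarith
    · exact (B.h_avail i).trans h.le
  · have hl : 0 < B.lam (B.toSchedule.π i) := by
      obtain ⟨q, hq⟩ := B.h_lam_pow (B.toSchedule.π i)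
      rw [hq]
      positivity
    rcases le_or_gt (I.r (B.toSchedule.π k)) (B.dec (B.toSchedule.π i)) with h | h
    · have hs := B.h_select i k hik h
      split_ifs at hs <;> linarith
    · have := B.h_avail i
      linarith
end

section
/- Consider the schedule produced by BALANCE. If job j1 is processed before job j2 and no job is processed in between, then F_{j2} ≤ F_{j1} + p_{j2} + s + λ(j1). -/
open Finset MeasureTheory ProbabilityTheory

attribute [local instance] Classical.propDecidable

/-- Proposition 2: in a schedule produced by BALANCE, if job `j₁` is
processed directly before job `j₂` (no job in between), then
`F_{j₂} ≤ F_{j₁} + p_{j₂} + s + λ(j₁)`. -/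
theorem balance_flowtime {n : ℕ} (I : SInstance n) (hp : ∀ j, 1 ≤ I.p j)
    (B : BalanceSchedule I) :
    ∀ i : Fin n, 0 < i.val →
      B.toSchedule.flow (B.toSchedule.π i) ≤
        B.toSchedule.flow (B.toSchedule.π (prevFin i)) + I.p (B.toSchedule.π i)
          + I.s + B.lam (B.toSchedule.π (prevFin i)) := by
  intro i hi
  have hlt : prevFin i < i := by
    rw [Fin.lt_def]
    simp only [prevFin]
    omega
  have hlam : 0 ≤ B.lam (B.toSchedule.π (prevFin i)) := by
    obtain ⟨q, hq⟩ := B.h_lam_pow (B.toSchedule.π (prevFin i))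
    rw [hq]
    positivity
  have hs := I.hs
  have hrel := B.toSchedule.h_release (B.toSchedule.π (prevFin i))
  have hp1 := hp (B.toSchedule.π (prevFin i))
  have hstart : B.toSchedule.t (B.toSchedule.π i) ≤ B.dec (B.toSchedule.π i) + I.s := by
    rw [B.h_dec_start i]
    split_ifs <;> linarith
  have hav := B.h_avail (prevFin i)
  rcases (B.h_no_idle i hi).2 with h | h
  · have key : I.r (B.toSchedule.π (prevFin i)) ≤
        I.r (B.toSchedule.π i) + B.lam (B.toSchedule.π (prevFin i)) := by
      by_cases hr : I.r (B.toSchedule.π i) ≤ B.dec (B.toSchedule.π (prevFin i))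
      · have hsel := B.h_select (prevFin i) i hlt hr
        split_ifs at hsel <;> linarith
      · linarith
    simp only [Schedule.flow, Schedule.c] at *
    linarith
  · have hk := h i le_rfl
    simp only [Schedule.flow, Schedule.c] at *
    linarith
end

section
/- Let α^{q+1} ≤ F < α^{q+2}, 3 ≤ δ ≤ α−10 and α^q ≥ F*, where F is BALANCE's maximum flow time. Then F ≤ α²(δ−2)^{−1}·(F* + overhead_ALG(S^δ_{α^q}) − overhead_OPT(I(S^δ_{α^q}))). -/
open Finset MeasureTheory ProbabilityTheory

attribute [local instance] Classical.propDecidable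

section Helpers

variable {n : ℕ} {I : SInstance n}

/-- Jobs processed earlier complete before later jobs start. -/
lemma sched_c_le_t (hp : ∀ j, 1 ≤ I.p j) (S : Schedule I) (i : Fin n) :
    ∀ m : ℕ, ∀ hm : m < n, i.val < m → S.c (S.π i) ≤ S.t (S.π ⟨m, hm⟩) := by
  intro m
  induction m with
  | zero => intro _ h; omega
  | succ m ih =>
    intro hm h
    have hg := S.h_gap ⟨m + 1, hm⟩ (Nat.succ_pos m)
    have hprev : prevFin (⟨m + 1, hm⟩ : Fin n) = ⟨m, by omega⟩ := rfl
    rw [hprev] at hg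
    have hs : (0 : ℝ) ≤ (if I.τ (S.π ⟨m, by omega⟩) ≠ I.τ (S.π ⟨m + 1, hm⟩) then I.s else 0) := by
      split_ifs
      · exact I.hs
      · exact le_refl _
    have hpm := hp (S.π ⟨m, by omega⟩)
    rcases Nat.lt_succ_iff_lt_or_eq.mp h with h1 | h1
    · have := ih (by omega) h1
      linarith
    · have hi : i = ⟨m, by omega⟩ := Fin.ext h1
      rw [hi]
      unfold Schedule.c
      linarith

lemma sched_t_inj (hp : ∀ j, 1 ≤ I.p j) (S : Schedule I) : Function.Injective S.t := by
  intro x y hxy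
  obtain ⟨i, rfl⟩ := S.π.surjective x
  obtain ⟨k, rfl⟩ := S.π.surjective y
  rcases lt_trichotomy i k with h | h | h
  · have := sched_c_le_t hp S i k.val k.isLt h
    have hpp := hp (S.π i)
    unfold Schedule.c at this
    simp only [Fin.eta] at this
    linarith
  · rw [h]
  · have := sched_c_le_t hp S k i.val i.isLt h
    have hpp := hp (S.π k)
    unfold Schedule.c at this
    simp only [Fin.eta] at this
    linarith

lemma sched_overhead_nonneg (S : Schedule I) (i : Fin n) : 0 ≤ S.overheadAt i := by
  unfold Schedule.overheadAt
  split_ifs with h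
  · have hg := S.h_gap i h
    have hs : (0 : ℝ) ≤ (if I.τ (S.π (prevFin i)) ≠ I.τ (S.π i) then I.s else 0) := by
      split_ifs
      · exact I.hs
      · exact le_refl _
    unfold Schedule.c
    linarith
  · exact (I.hr _).trans (S.h_release _)

/-- Telescoping of overhead and processing time. -/
lemma sched_telescope (S : Schedule I) (b : Fin n) :
    ∀ m : ℕ, ∀ hm : m < n, b.val ≤ m →
      ∑ i ∈ Finset.Icc b ⟨m, hm⟩, (S.overheadAt i + I.p (S.π i)) =
        S.c (S.π ⟨m, hm⟩) - S.t (S.π b) + S.overheadAt b := by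
  intro m
  induction m with
  | zero =>
    intro hm h
    have hb : b = ⟨0, hm⟩ := Fin.ext (by simpa using h)
    subst hb
    simp [Schedule.c]
    ring
  | succ m ih =>
    intro hm h
    rcases Nat.lt_or_eq_of_le h with h1 | h1
    · have hset : Finset.Icc b ⟨m + 1, hm⟩ =
          insert (⟨m + 1, hm⟩ : Fin n) (Finset.Icc b ⟨m, by omega⟩) := by
        ext x
        simp only [Finset.mem_Icc, Finset.mem_insert, Fin.le_def, Fin.ext_iff]
        omega
      rw [hset, Finset.sum_insert (by simp [Fin.le_def]), ih (by omega) (by omega)]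
      have hprev : prevFin (⟨m + 1, hm⟩ : Fin n) = ⟨m, by omega⟩ := rfl
      have ho : S.overheadAt ⟨m + 1, hm⟩ =
          S.t (S.π ⟨m + 1, hm⟩) - S.c (S.π ⟨m, by omega⟩) := by
        unfold Schedule.overheadAt
        rw [if_pos (Nat.succ_pos m), hprev]
      rw [ho]
      simp only [Schedule.c]
      ring
    · have hb : b = ⟨m + 1, hm⟩ := Fin.ext h1
      subst hb
      simp [Schedule.c]
      ring

lemma flow_le_maxFlow (S : Schedule I) (j : Fin n) : S.flow j ≤ S.maxFlow :=
  le_csSup (Set.finite_range _).bddAbove ⟨j, rfl⟩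

/-- Bound on the overhead of a schedule on the jobs released in an interval. -/
lemma overheadOn_le (hp : ∀ j, 1 ≤ I.p j) (S : Schedule I) (lo hi : ℝ) (P : Fin n → Prop)
    (hP : ∀ j, P j → I.r j ∈ Set.Icc lo hi) (hne : ∃ j, P j) :
    S.overheadOn P ≤
      hi + S.maxFlow - lo -
        ∑ j ∈ Finset.univ.filter P, I.p j := by
  have hN : (Finset.univ.filter P).Nonempty := by
    obtain ⟨j, hj⟩ := hne
    exact ⟨j, by simpa using hj⟩
  unfold Schedule.overheadOn
  rw [dif_pos hN]
  obtain ⟨l, hlm, hl⟩ := Finset.exists_mem_eq_sup' hN S.t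
  have h1 : lo ≤ (Finset.univ.filter P).inf' hN S.t := by
    refine Finset.le_inf' hN _ ?_
    intro j hj
    have := hP j (Finset.mem_filter.mp hj).2
    exact this.1.trans (S.h_release j)
  have h2 : S.t l + I.p l ≤ hi + S.maxFlow := by
    have h3 := flow_le_maxFlow S l
    have h4 := (hP l (Finset.mem_filter.mp hlm).2).2
    simp only [Schedule.flow, Schedule.c] at h3
    linarith
  rw [← Finset.sum_filter]
  have h5 : ∑ j ∈ (Finset.univ.filter P).erase l, I.p j ≤
      ∑ j ∈ Finset.univ.filter (fun j =>
        (Finset.univ.filter P).inf' hN S.t ≤ S.t j ∧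
        S.t j < (Finset.univ.filter P).sup' hN S.t), I.p j := by
    refine Finset.sum_le_sum_of_subset_of_nonneg ?_ ?_
    · intro j hj
      obtain ⟨hjl, hjm⟩ := Finset.mem_erase.mp hj
      refine Finset.mem_filter.mpr ⟨Finset.mem_univ _, Finset.inf'_le _ hjm, ?_⟩
      refine lt_of_le_of_ne (Finset.le_sup' _ hjm) ?_
      rw [hl]
      exact fun h => hjl (sched_t_inj hp S h)
    · intro j _ _
      linarith [hp j]
  have h6 := Finset.add_sum_erase _ I.p hlm
  linarith

lemma lam_mono (B : BalanceSchedule I) (i : Fin n) :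
    ∀ m : ℕ, ∀ hm : m < n, i.val ≤ m →
      B.lam (B.toSchedule.π i) ≤ B.lam (B.toSchedule.π ⟨m, hm⟩) := by
  intro m
  induction m with
  | zero =>
    intro hm h
    have hb : i = ⟨0, hm⟩ := Fin.ext (by simpa using h)
    rw [hb]
  | succ m ih =>
    intro hm h
    rcases Nat.lt_or_eq_of_le h with h1 | h1
    · exact (ih (by omega) (by omega)).trans (B.h_lam_mono ⟨m + 1, hm⟩ (Nat.succ_pos m))
    · have hb : i = ⟨m + 1, hm⟩ := Fin.ext h1
      rw [hb]

end Helpers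

/-- Lemma 2: let `α^{q+1} ≤ F < α^{q+2}`, `3 ≤ δ ≤ α − 10` and
`α^q ≥ F*`.  Then
`F ≤ α²·(δ−2)⁻¹·(F* + overhead_ALG(S^δ_{α^q}) − overhead_OPT(I(S^δ_{α^q})))`,
where `I(S^δ_{α^q})` is the interval spanned by the release times of the jobs of
`S^δ_{α^q}`. -/
theorem balance_competitiveness_bound {n : ℕ} (I : SInstance n) (hp : ∀ j, 1 ≤ I.p j)
    (B : BalanceSchedule I) (O : Schedule I) (hO : O.IsOptimal)
    (q : ℕ) (δ : ℝ) (hδ1 : 3 ≤ δ) (hδ2 : δ ≤ 13 - 10)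
    (hq : O.maxFlow ≤ 13 ^ q)
    (hF1 : (13 : ℝ) ^ (q + 1) ≤ B.toSchedule.maxFlow)
    (hF2 : B.toSchedule.maxFlow < (13 : ℝ) ^ (q + 2))
    (b : Fin n) (hb : B.IsSdStart q δ b)
    (lo hi : ℝ)
    (hlo : (∃ i : Fin n, b ≤ i ∧ B.inS q i ∧ I.r (B.toSchedule.π i) = lo) ∧
      ∀ i : Fin n, b ≤ i → B.inS q i → lo ≤ I.r (B.toSchedule.π i))
    (hhi : (∃ i : Fin n, b ≤ i ∧ B.inS q i ∧ I.r (B.toSchedule.π i) = hi) ∧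
      ∀ i : Fin n, b ≤ i → B.inS q i → I.r (B.toSchedule.π i) ≤ hi) :
    B.toSchedule.maxFlow ≤
      13 ^ 2 * (δ - 2)⁻¹ *
        (O.maxFlow
          + (∑ i : Fin n, if b ≤ i ∧ B.inS q i then B.toSchedule.overheadAt i else 0)
          - O.overheadOn (fun j => I.r j ∈ Set.Icc lo hi)) := by
  have hδ : δ = 3 := by linarith
  subst hδ
  obtain ⟨hbS, hbB, hbF, -⟩ := hb
  have hL : (0 : ℝ) < 13 ^ q := by positivity
  have hpow1 : (13 : ℝ) ^ (q + 1) = 13 * 13 ^ q := by ring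
  have hpow2 : (13 : ℝ) ^ (q + 2) = 169 * 13 ^ q := by ring
  -- last position of the subschedule
  obtain ⟨e, heS, hemax⟩ : ∃ e : Fin n, B.inS q e ∧ ∀ i, B.inS q i → i ≤ e := by
    have hN : (Finset.univ.filter (fun i => B.inS q i)).Nonempty := ⟨b, by simpa using hbS⟩
    refine ⟨(Finset.univ.filter (fun i => B.inS q i)).max' hN, ?_, ?_⟩
    · exact (Finset.mem_filter.mp (Finset.max'_mem _ hN)).2
    · intro i hi
      exact Finset.le_max' _ _ (by simpa using hi)
  have hbe : b ≤ e := hemax b hbS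
  have hset : ∀ i : Fin n, (b ≤ i ∧ B.inS q i) ↔ i ∈ Finset.Icc b e := by
    intro i
    rw [Finset.mem_Icc]
    constructor
    · exact fun h => ⟨h.1, hemax i h.2⟩
    · intro h
      refine ⟨h.1, ?_⟩
      have h1 := lam_mono B b i.val i.isLt h.1
      have h2 := lam_mono B i e.val e.isLt h.2
      simp only [Fin.eta] at h1 h2
      unfold BalanceSchedule.inS at hbS heS ⊢
      linarith
  -- the last job has large flow time
  have heF : 13 * 13 ^ q ≤ B.toSchedule.flow (B.toSchedule.π e) := by
    by_cases hen : e.val + 1 < n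
    · have hm := B.h_lam_mono ⟨e.val + 1, hen⟩ (Nat.succ_pos _)
      have hmin := B.h_lam_min ⟨e.val + 1, hen⟩ (Nat.succ_pos _)
      have hprev : prevFin (⟨e.val + 1, hen⟩ : Fin n) = e := rfl
      rw [hprev] at hm hmin
      have hnot : ¬ B.inS q ⟨e.val + 1, hen⟩ := by
        intro h
        have := hemax _ h
        simp [Fin.le_def] at this
      unfold BalanceSchedule.inS at heS hnot
      rw [heS] at hm hmin
      rcases hmin with h | h
      · exact absurd h hnot
      · obtain ⟨q', hq'⟩ := B.h_lam_pow (B.toSchedule.π ⟨e.val + 1, hen⟩)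
        rw [hq'] at hm hnot h
        have hlt : (13 : ℝ) ^ q < 13 ^ q' := lt_of_le_of_ne hm (Ne.symm hnot)
        have hqq : q < q' := (pow_lt_pow_iff_right₀ (by norm_num)).mp hlt
        have : (13 : ℝ) ^ (q + 1) ≤ 13 ^ q' := pow_le_pow_right₀ (by norm_num) hqq
        linarith
    · have : Nonempty (Fin n) := ⟨b⟩
      obtain ⟨j, hj⟩ : B.toSchedule.maxFlow ∈ Set.range B.toSchedule.flow :=
        (Set.range_nonempty _).csSup_mem (Set.finite_range _)
      obtain ⟨i, rfl⟩ := B.toSchedule.π.surjective j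
      rw [← hj] at hF1
      by_cases hie : i = e
      · subst hie
        linarith
      · have hlt : i.val + 1 < n := by
          have := i.isLt
          have h3 : i.val ≠ e.val := fun h => hie (Fin.ext h)
          have := e.isLt
          omega
        have hbd := B.h_lam_bound ⟨i.val + 1, hlt⟩ (Nat.succ_pos _)
        have hprev : prevFin (⟨i.val + 1, hlt⟩ : Fin n) = i := rfl
        rw [hprev] at hbd
        have hm := lam_mono B ⟨i.val + 1, hlt⟩ e.val e.isLt (by
          show i.val + 1 ≤ e.val
          omega)
        simp only [Fin.eta] at hm
        unfold BalanceSchedule.inS at heS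
        linarith
  -- `b` has the smallest release time
  have hlob : I.r (B.toSchedule.π b) ≤ lo := by
    obtain ⟨⟨i, hbi, hiS, hir⟩, -⟩ := hlo
    rw [← hir]
    rcases eq_or_lt_of_le hbi with h | h
    · rw [h]
    · by_cases hd : I.r (B.toSchedule.π i) ≤ B.dec (B.toSchedule.π b)
      · have hsel := B.h_select b i h hd
        have hnb : ¬ (0 < b.val ∧
            I.τ (B.toSchedule.π b) = I.τ (B.toSchedule.π (prevFin b))) := by
          rintro ⟨h1, h2⟩
          rcases hbB with h3 | h3
          · omega
          · exact h3 h2.symm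
        rw [if_neg hnb] at hsel
        unfold BalanceSchedule.inS at hbS
        rw [hbS] at hsel
        split_ifs at hsel <;> linarith
      · have := B.h_avail b
        linarith
  -- `hi` is close to the release time of the last job
  have hhie : hi ≤ I.r (B.toSchedule.π e) + 13 ^ q := by
    obtain ⟨⟨i, hbi, hiS, hir⟩, -⟩ := hhi
    rw [← hir]
    rcases eq_or_lt_of_le (hemax i hiS) with h | h
    · rw [h]; linarith
    · by_cases hd : I.r (B.toSchedule.π e) ≤ B.dec (B.toSchedule.π i)
      · have hsel := B.h_select i e h hd
        unfold BalanceSchedule.inS at hiS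
        rw [hiS] at hsel
        split_ifs at hsel <;> linarith
      · have := B.h_avail i
        linarith
  have htel := sched_telescope B.toSchedule b e.val e.isLt hbe
  simp only [Fin.eta] at htel
  rw [Finset.sum_add_distrib] at htel
  have hov : (∑ i : Fin n, if b ≤ i ∧ B.inS q i then B.toSchedule.overheadAt i else 0) =
      ∑ i ∈ Finset.Icc b e, B.toSchedule.overheadAt i := by
    rw [← Finset.sum_filter]
    congr 1
    ext i
    simp only [Finset.mem_filter, Finset.mem_univ, true_and]
    exact hset i
  obtain ⟨P, hPdef⟩ : ∃ P : Fin n → Prop, P = fun j => I.r j ∈ Set.Icc lo hi := ⟨_, rfl⟩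
  have hPi : ∀ j, P j ↔ I.r j ∈ Set.Icc lo hi := fun j => by rw [hPdef]
  have hwork : ∑ i ∈ Finset.Icc b e, I.p (B.toSchedule.π i) ≤
      ∑ j ∈ Finset.univ.filter P, I.p j := by
    have hmap := Finset.sum_map (Finset.Icc b e) B.toSchedule.π.toEmbedding I.p
    simp only [Equiv.coe_toEmbedding] at hmap
    rw [← hmap]
    refine Finset.sum_le_sum_of_subset_of_nonneg ?_ ?_
    · intro j hj
      obtain ⟨i, hi1, rfl⟩ := Finset.mem_map.mp hj
      have hi2 := (hset i).mpr hi1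
      exact Finset.mem_filter.mpr ⟨Finset.mem_univ _,
        (hPi _).mpr ⟨hlo.2 i hi2.1 hi2.2, hhi.2 i hi2.1 hi2.2⟩⟩
    · intro j _ _
      linarith [hp j]
  have hopt := overheadOn_le hp O lo hi P (fun j => (hPi j).mp)
    ⟨B.toSchedule.π b, (hPi _).mpr ⟨hlo.2 b le_rfl hbS, hhi.2 b le_rfl hbS⟩⟩
  have hob := sched_overhead_nonneg B.toSchedule b
  have hpb := hp (B.toSchedule.π b)
  simp only [Schedule.flow, Schedule.c] at hbF heF htel
  have hc : (13 : ℝ) ^ 2 * (3 - 2)⁻¹ = 169 := by norm_num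
  rw [hov, hc, ← hPdef]
  linarith
end

section
/- Let α^q ≥ F* and δ ≤ α−10, and consider S^δ_{α^q}. For a type τ, let j_{τ,i} denote the first job of the i-th batch of type τ in S^δ_{α^q}. Then r_{j_{τ,i}} > r_{j_{τ,i−1}} + α^q for all i ≥ 2 and all types τ. -/
open Finset MeasureTheory ProbabilityTheory

attribute [local instance] Classical.propDecidable

theorem aux_sched_order {n : ℕ} {I : SInstance n} (hp : ∀ j, 1 ≤ I.p j) (S : Schedule I)
    (a : Fin n) : ∀ (m : ℕ) (hm : m < n), a.val < m →
      S.t (S.π a) + I.p (S.π a) + (if I.τ (S.π a) ≠ I.τ (S.π ⟨m, hm⟩) then I.s else 0)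
        ≤ S.t (S.π ⟨m, hm⟩) := by
  intro m
  induction m with
  | zero => intro _ h; omega
  | succ m ih =>
    intro hm ham
    have hg := S.h_gap ⟨m + 1, hm⟩ (Nat.succ_pos m)
    have hprev : prevFin (⟨m + 1, hm⟩ : Fin n) = ⟨m, by omega⟩ := by
      simp [prevFin]
    rw [hprev] at hg
    by_cases h : a.val = m
    · have : a = ⟨m, by omega⟩ := Fin.ext h
      rw [this]; exact hg
    · have h2 := ih (by omega) (by omega)
      have hp1 := hp (S.π ⟨m, by omega⟩)
      have hs := I.hs
      by_cases e1 : I.τ (S.π a) = I.τ (S.π ⟨m, by omega⟩) <;>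
      by_cases e2 : I.τ (S.π ⟨m, by omega⟩) = I.τ (S.π ⟨m + 1, hm⟩) <;>
      by_cases e3 : I.τ (S.π a) = I.τ (S.π ⟨m + 1, hm⟩) <;>
      simp only [e1, e2, e3, ne_eq, not_true_eq_false, not_false_eq_true, if_true, if_false] at h2 hg ⊢ <;>
      first
        | linarith
        | exact absurd (e1.trans e2) e3
        | (simp_all; done)
        | (split_ifs at * <;> linarith)

theorem aux_flow_le {n : ℕ} {I : SInstance n} (S : Schedule I) (j : Fin n) :
    S.flow j ≤ S.maxFlow :=
  le_csSup (Set.finite_range S.flow).bddAbove ⟨j, rfl⟩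

/-- Jobs of different types: one is released much later than the other one. -/
theorem aux_sep {n : ℕ} {I : SInstance n} (hp : ∀ j, 1 ≤ I.p j) (S : Schedule I) (L : ℝ)
    (hL : S.maxFlow ≤ L) (x y : Fin n) (hxy : I.τ x ≠ I.τ y) :
    I.r x + I.s - L < I.r y ∨ I.r y + I.s - L < I.r x := by
  have key : ∀ x y : Fin n, I.τ x ≠ I.τ y → S.π.symm x < S.π.symm y →
      I.r x + I.s - L < I.r y := by
    intro x y hxy hlt
    have h := aux_sched_order hp S (S.π.symm x) (S.π.symm y).val (S.π.symm y).isLt hlt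
    simp only [Fin.eta, Equiv.apply_symm_apply, if_pos hxy] at h
    have hf := (aux_flow_le S y).trans hL
    unfold Schedule.flow Schedule.c at hf
    have := S.h_release x
    have := hp x
    have := hp y
    linarith
  rcases lt_trichotomy (S.π.symm x) (S.π.symm y) with h | h | h
  · exact Or.inl (key x y hxy h)
  · exact absurd (congrArg I.τ (S.π.symm.injective h)) hxy
  · exact Or.inr (key y x (Ne.symm hxy) h)

theorem aux_lam_mono {n : ℕ} {I : SInstance n} (B : BalanceSchedule I) (a : Fin n) :
    ∀ (m : ℕ) (hm : m < n), a.val ≤ m →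
      B.lam (B.toSchedule.π a) ≤ B.lam (B.toSchedule.π ⟨m, hm⟩) := by
  intro m
  induction m with
  | zero =>
    intro hm h
    have : a = ⟨0, hm⟩ := Fin.ext (by simpa using h)
    rw [this]
  | succ m ih =>
    intro hm h
    by_cases e : a.val = m + 1
    · have : a = ⟨m + 1, hm⟩ := Fin.ext e
      rw [this]
    · exact (ih (by omega) (by omega)).trans (B.h_lam_mono ⟨m + 1, hm⟩ (Nat.succ_pos m))

/-- Lemma 3: given `S^δ_{α^q}` (with `α^q ≥ F*`, `δ ≤ α − 10`), the
release times of the first jobs of two consecutive batches of the same type `τ` in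
`S^δ_{α^q}` differ by more than `α^q`: `r_{j_{τ,i}} > r_{j_{τ,i−1}} + α^q`. -/
theorem balance_releaseDiff_sameType {n : ℕ} (I : SInstance n) (hp : ∀ j, 1 ≤ I.p j)
    (B : BalanceSchedule I) (O : Schedule I) (hO : O.IsOptimal)
    (q : ℕ) (hq : O.maxFlow ≤ 13 ^ q) (δ : ℝ) (hδ : δ ≤ 13 - 10)
    (b : Fin n) (hb : B.IsSdStart q δ b)
    (τ0 : ℕ) (i₁ i₂ : Fin n) (h12 : i₁ < i₂)
    (h1 : b ≤ i₁ ∧ B.inS q i₁ ∧ B.toSchedule.startsBatch i₁ ∧ I.τ (B.toSchedule.π i₁) = τ0)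
    (h2 : b ≤ i₂ ∧ B.inS q i₂ ∧ B.toSchedule.startsBatch i₂ ∧ I.τ (B.toSchedule.π i₂) = τ0)
    (hconsec : ∀ m : Fin n, i₁ < m → m < i₂ →
      ¬ (B.toSchedule.startsBatch m ∧ I.τ (B.toSchedule.π m) = τ0)) :
    I.r (B.toSchedule.π i₁) + 13 ^ q < I.r (B.toSchedule.π i₂) := by
  obtain ⟨hb1, hS1, hst1, ht1⟩ := h1
  obtain ⟨hb2, hS2, hst2, ht2⟩ := h2
  obtain ⟨-, -, -, hlast⟩ := hb
  have h12v : i₁.val < i₂.val := h12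
  -- the first position after `i₁` of another type
  have hpt : I.τ (B.toSchedule.π (prevFin i₂)) ≠ τ0 := by
    rcases hst2 with h | h
    · omega
    · rwa [ht2] at h
  have hex : ∃ m : ℕ, i₁.val < m ∧ ∃ hm : m < n, I.τ (B.toSchedule.π ⟨m, hm⟩) ≠ τ0 := by
    refine ⟨(prevFin i₂).val, ?_, (prevFin i₂).isLt, hpt⟩
    have hne : (prevFin i₂).val ≠ i₁.val := by
      intro h
      exact hpt (by rw [Fin.ext h]; exact ht1)
    simp only [prevFin] at hne ⊢
    omega
  obtain ⟨k, hk, hki2, hkt, hkp⟩ : ∃ k : Fin n, i₁ < k ∧ k < i₂ ∧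
      I.τ (B.toSchedule.π k) ≠ τ0 ∧ I.τ (B.toSchedule.π (prevFin k)) = τ0 := by
    have hspec := Nat.find_spec hex
    obtain ⟨hlt, hm, hty⟩ := hspec
    refine ⟨⟨Nat.find hex, hm⟩, hlt, ?_, hty, ?_⟩
    · have : Nat.find hex ≤ (prevFin i₂).val := by
        apply Nat.find_min' hex
        refine ⟨?_, (prevFin i₂).isLt, hpt⟩
        have hne : (prevFin i₂).val ≠ i₁.val := by
          intro h
          exact hpt (by rw [Fin.ext h]; exact ht1)
        simp only [prevFin] at hne ⊢
        omega
      show Nat.find hex < i₂.val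
      simp only [prevFin] at this
      omega
    · by_cases e : Nat.find hex - 1 = i₁.val
      · have : prevFin (⟨Nat.find hex, hm⟩ : Fin n) = i₁ := Fin.ext e
        rw [this]; exact ht1
      · by_contra hc
        have := Nat.find_min' hex (m := Nat.find hex - 1) ⟨by omega, by omega, hc⟩
        omega
  have hkpos : 0 < k.val := lt_of_le_of_lt (Nat.zero_le _) hk
  have hkst : B.toSchedule.startsBatch k := Or.inr (by rw [hkp]; exact hkt.symm)
  have hlamk : B.lam (B.toSchedule.π k) = 13 ^ q := by
    have h1 := aux_lam_mono B i₁ k.val k.isLt (le_of_lt hk)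
    have h2 := aux_lam_mono B k i₂.val i₂.isLt (le_of_lt hki2)
    unfold BalanceSchedule.inS at hS1 hS2
    rw [hS1] at h1
    rw [show (⟨i₂.val, i₂.isLt⟩ : Fin n) = i₂ from rfl, hS2] at h2
    exact le_antisymm h2 h1
  have hflow := hlast k (lt_of_le_of_lt hb1 hk) hlamk hkst
  have hL : (0 : ℝ) < 13 ^ q := by positivity
  -- `r i₁ ≤ r k`
  have hr1k : I.r (B.toSchedule.π i₁) ≤ I.r (B.toSchedule.π k) := by
    by_cases hrel : I.r (B.toSchedule.π k) ≤ B.dec (B.toSchedule.π i₁)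
    · have hsel := B.h_select i₁ k hk hrel
      have hno : ¬ (0 < i₁.val ∧
          I.τ (B.toSchedule.π i₁) = I.τ (B.toSchedule.π (prevFin i₁))) := by
        rintro ⟨h0, he⟩
        rcases hst1 with h | h
        · omega
        · exact h he.symm
      rw [if_neg hno] at hsel
      have hl : B.lam (B.toSchedule.π i₁) = 13 ^ q := hS1
      rw [hl] at hsel
      split_ifs at hsel <;> linarith
    · exact (B.h_avail i₁).trans (le_of_lt (not_le.mp hrel))
  have hsep1 := aux_sep hp O (13 ^ q) hq (B.toSchedule.π i₁) (B.toSchedule.π k)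
    (by rw [ht1]; exact hkt.symm)
  by_cases hrel : I.r (B.toSchedule.π i₂) ≤ B.dec (B.toSchedule.π k)
  · have hsel := B.h_select k i₂ hki2 hrel
    have htie := B.h_tie k i₂ hki2 hrel hkpos
    have hkt2 : ¬ (I.τ (B.toSchedule.π k) = τ0) := hkt
    simp only [hkp, ht2, hkt2, hkpos, hlamk, and_false, and_true, if_true, if_false] at hsel htie
    have hne : I.r (B.toSchedule.π k) + 13 ^ q ≠ I.r (B.toSchedule.π i₂) + 0 :=
      fun h => htie h trivial
    have := lt_of_le_of_ne hsel hne
    linarith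
  · have hrel := not_le.mp hrel
    have hav := B.h_avail k
    by_cases hs : I.s ≤ 2 * 13 ^ q
    · have hds := B.h_dec_start k
      rw [if_pos hkst] at hds
      have hf := (aux_flow_le O (B.toSchedule.π k)).trans hq
      have hre := O.h_release (B.toSchedule.π k)
      have h10 : (10 : ℝ) * 13 ^ q ≤ (13 - δ) * 13 ^ q :=
        mul_le_mul_of_nonneg_right (by linarith) hL.le
      unfold Schedule.flow Schedule.c at hf hflow
      linarith
    · rcases hsep1 with h | h <;> linarith
end

section
/- Let k = 2, α^q ≥ F* and δ ≤ α−10, and consider S^δ_{α^q}. Let j_i denote the first job of the i-th batch in S^δ_{α^q} (the batches alternate between the two types). Then r_{j_i} > r_{j_{i−1}} + α^q for all i ≥ 3. -/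
open Finset MeasureTheory ProbabilityTheory

attribute [local instance] Classical.propDecidable

/-- In a feasible schedule, a job of a different type processed later starts at least
`p + s` after an earlier job. -/
theorem schedule_gap_aux {n : ℕ} {I : SInstance n} (hp : ∀ j, 1 ≤ I.p j) (O : Schedule I)
    (x : Fin n) (m : ℕ) (hxm : x.val + 1 ≤ m) :
    ∀ hm : m < n, O.t (O.π x) + I.p (O.π x) +
      (if I.τ (O.π x) ≠ I.τ (O.π ⟨m, hm⟩) then I.s else 0) ≤ O.t (O.π ⟨m, hm⟩) := by
  induction m, hxm using Nat.le_induction with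
  | base =>
    intro hm
    have h := O.h_gap ⟨x.val + 1, hm⟩ (Nat.succ_pos _)
    have e : prevFin (⟨x.val + 1, hm⟩ : Fin n) = x := by
      apply Fin.ext; simp [prevFin]
    rw [e] at h
    exact h
  | succ k hk ih =>
    intro hm
    have h := O.h_gap ⟨k + 1, hm⟩ (Nat.succ_pos _)
    have e : prevFin (⟨k + 1, hm⟩ : Fin n) = ⟨k, by omega⟩ := by
      apply Fin.ext; simp [prevFin]
    rw [e] at h
    have ih' := ih (by omega)
    have hpk := hp (O.π ⟨k, by omega⟩)
    have hs := I.hs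
    by_cases h1 : I.τ (O.π x) = I.τ (O.π ⟨k, by omega⟩)
    · rw [h1] at ih' ⊢
      simp only [ne_eq, not_true_eq_false, if_false] at ih'
      linarith
    · rw [if_pos h1] at ih'
      split_ifs at h ⊢ <;> linarith

theorem schedule_gap {n : ℕ} {I : SInstance n} (hp : ∀ j, 1 ≤ I.p j) (O : Schedule I)
    (a b : Fin n) (hab : I.τ a ≠ I.τ b) :
    O.t a + I.p a + I.s ≤ O.t b ∨ O.t b + I.p b + I.s ≤ O.t a := by
  rcases lt_trichotomy (O.π.symm a).val (O.π.symm b).val with h | h | h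
  · left
    have := schedule_gap_aux hp O (O.π.symm a) _ h (O.π.symm b).isLt
    simpa [hab] using this
  · exact absurd (congrArg I.τ (O.π.symm.injective (Fin.ext h))) hab
  · right
    have := schedule_gap_aux hp O (O.π.symm b) _ h (O.π.symm a).isLt
    simpa [hab.symm] using this

theorem flow_le_maxFlow_s9 {n : ℕ} {I : SInstance n} (O : Schedule I) (j : Fin n) :
    O.flow j ≤ O.maxFlow :=
  le_csSup (Set.finite_range _).bddAbove ⟨j, rfl⟩

/-- Lemma 5: let `k = 2`, `α^q ≥ F*`, `δ ≤ α − 10` and consider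
`S^δ_{α^q}`.  If `j_i` denotes the first job of the `i`-th batch of `S^δ_{α^q}`,
then `r_{j_i} > r_{j_{i−1}} + α^q` for all `i ≥ 3`, i.e. for any two consecutive
batch starts after the first batch of `S^δ_{α^q}`. -/
theorem balance_releaseDiff_twoTypes {n : ℕ} (I : SInstance n) (hp : ∀ j, 1 ≤ I.p j)
    (hk : ∀ j, I.τ j < 2)
    (B : BalanceSchedule I) (O : Schedule I) (hO : O.IsOptimal)
    (q : ℕ) (hq : O.maxFlow ≤ 13 ^ q) (δ : ℝ) (hδ : δ ≤ 13 - 10)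
    (b : Fin n) (hb : B.IsSdStart q δ b)
    (i₁ i₂ : Fin n) (hbi : b < i₁) (h12 : i₁ < i₂)
    (h1 : B.inS q i₁ ∧ B.toSchedule.startsBatch i₁)
    (h2 : B.inS q i₂ ∧ B.toSchedule.startsBatch i₂)
    (hconsec : ∀ m : Fin n, i₁ < m → m < i₂ → ¬ B.toSchedule.startsBatch m) :
    I.r (B.toSchedule.π i₁) + 13 ^ q < I.r (B.toSchedule.π i₂) := by
  have hi1 : 0 < i₁.val := by have : b.val < i₁.val := hbi; omega
  have h12' : i₁.val < i₂.val := h12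
  have hτ1 : I.τ (B.π (prevFin i₁)) ≠ I.τ (B.π i₁) := by
    rcases h1.2 with h | h
    · omega
    · exact h
  have hτ2 : I.τ (B.π (prevFin i₂)) ≠ I.τ (B.π i₂) := by
    rcases h2.2 with h | h
    · omega
    · exact h
  have key : ∀ m : ℕ, i₁.val ≤ m → ∀ hm : m < n, m < i₂.val →
      I.τ (B.π ⟨m, hm⟩) = I.τ (B.π i₁) := by
    intro m hm
    induction m, hm using Nat.le_induction with
    | base => intro _ _; rfl
    | succ k hk ih =>
      intro hm hlt
      have hn := hconsec ⟨k + 1, hm⟩ (Fin.lt_def.2 (by simp; omega)) (Fin.lt_def.2 hlt)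
      have e : prevFin (⟨k + 1, hm⟩ : Fin n) = ⟨k, by omega⟩ := by
        apply Fin.ext; simp [prevFin]
      have hn2 : I.τ (B.π (prevFin ⟨k + 1, hm⟩)) = I.τ (B.π ⟨k + 1, hm⟩) := by
        by_contra hc
        exact hn (Or.inr hc)
      rw [← hn2, e]
      exact ih (by omega) (by omega)
  have hprev : I.τ (B.π (prevFin i₂)) = I.τ (B.π i₁) :=
    key (i₂.val - 1) (by omega) (by have := i₂.isLt; omega) (by omega)
  rw [hprev] at hτ2
  have hτ : I.τ (B.π i₂) = I.τ (B.π (prevFin i₁)) := by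
    have a1 := hk (B.π i₁)
    have a2 := hk (B.π i₂)
    have a3 := hk (B.π (prevFin i₁))
    omega
  have hlam : B.lam (B.π i₁) = 13 ^ q := h1.1
  by_cases hrel : I.r (B.π i₂) ≤ B.dec (B.π i₁)
  · have hsel := B.h_select i₁ i₂ h12 hrel
    have htie := B.h_tie i₁ i₂ h12 hrel hi1
    rw [if_neg (fun h => hτ1 h.2.symm), if_pos ⟨hi1, hτ⟩, hlam] at hsel
    rw [if_neg (fun h => hτ1 h.symm), if_pos hτ, hlam] at htie
    rcases lt_or_eq_of_le hsel with h | h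
    · linarith
    · exact absurd (htie h hτ).symm hτ1
  · by_contra hcon
    push Not at hrel hcon
    have hav := B.h_avail i₁
    have hst := B.h_dec_start i₁
    rw [if_pos h1.2] at hst
    have hfl := hb.2.2.2 i₁ hbi h1.1 h1.2
    push Not at hfl
    have hL : (0:ℝ) < 13 ^ q := by positivity
    have h10 : 10 * (13:ℝ) ^ q ≤ (13 - δ) * 13 ^ q :=
      mul_le_mul_of_nonneg_right (by linarith) hL.le
    have f1 := (flow_le_maxFlow_s9 O (B.π i₁)).trans hq
    have f2 := (flow_le_maxFlow_s9 O (B.π i₂)).trans hq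
    have r1 := O.h_release (B.π i₁)
    have r2 := O.h_release (B.π i₂)
    have p1 := hp (B.π i₁)
    have p2 := hp (B.π i₂)
    have g := schedule_gap hp O (B.π i₁) (B.π i₂) hτ2
    simp only [Schedule.flow, Schedule.c] at f1 f2 hfl
    rcases g with g | g <;> linarith
end
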